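/- For every real number λ with −1 < λ < 0, writing s = √(−λ) > 0, the set of eigenvalues of the 6×6 matrix H_toy(0,λ) is exactly {−5s, −3s, −s, s, 3s, 5s}: six pairwise distinct real eigenvalues forming an equidistant sequence with spacing 2s. In particular, the spectrum of H_toy(0,λ) is real, non-degenerate and equidistant for every λ in the interval (−1,0). -/

import Mathlib

open Matrix Polynomial

/-- The `6 × 6` real matrix `H_toy(g,λ)`: diagonal `(−5+g, −3, −1, 1, 3, 5−g)`,
superdiagonal `(√(5+5λ), 2√(2+2λ), 3√(1+λ), 2√(2+2λ), √(5+5λ))`, subdiagonal the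
negatives of the corresponding superdiagonal entries, all other entries zero. -/
noncomputable def Htoy (g lam : ℝ) : Matrix (Fin 6) (Fin 6) ℝ :=
  !![-5+g, Real.sqrt (5+5*lam), 0, 0, 0, 0;
     -Real.sqrt (5+5*lam), -3, 2*Real.sqrt (2+2*lam), 0, 0, 0;
     0, -(2*Real.sqrt (2+2*lam)), -1, 3*Real.sqrt (1+lam), 0, 0;
     0, 0, -(3*Real.sqrt (1+lam)), 1, 2*Real.sqrt (2+2*lam), 0;
     0, 0, 0, -(2*Real.sqrt (2+2*lam)), 3, Real.sqrt (5+5*lam);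
     0, 0, 0, 0, -Real.sqrt (5+5*lam), 5-g]

/-- The determinant of a tridiagonal `6 × 6` matrix, expanded by the three-term recurrence, when
the subdiagonal is the negative of the superdiagonal. -/
theorem det_tridiagonal_six {R : Type*} [CommRing R] (d₁ d₂ d₃ d₄ d₅ d₆ a b c : R) :
    (!![d₁, -a, 0, 0, 0, 0;
        a, d₂, -b, 0, 0, 0;
        0, b, d₃, -c, 0, 0;
        0, 0, c, d₄, -b, 0;
        0, 0, 0, b, d₅, -a;
        0, 0, 0, 0, a, d₆] : Matrix (Fin 6) (Fin 6) R).det =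
      (d₃ * (d₁ * d₂ + a ^ 2) + b ^ 2 * d₁) * (d₄ * (d₅ * d₆ + a ^ 2) + b ^ 2 * d₆) +
        c ^ 2 * (d₁ * d₂ + a ^ 2) * (d₅ * d₆ + a ^ 2) := by
  simp [Matrix.det_succ_row_zero, Fin.sum_univ_succ, Fin.succAbove]
  ring

/-- The characteristic polynomial of `H_toy(0,λ)`, evaluated at a complex number. -/
theorem det_algebraMap_sub_Htoy {lam s : ℝ} (h : -1 ≤ lam) (hs : s ^ 2 = -lam) (z : ℂ) :
    (algebraMap ℂ (Matrix (Fin 6) (Fin 6) ℂ) z - (Htoy 0 lam).map ((↑) : ℝ → ℂ)).det =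
      (z ^ 2 - (s : ℂ) ^ 2) * (z ^ 2 - (3 * s : ℂ) ^ 2) * (z ^ 2 - (5 * s : ℂ) ^ 2) := by
  have sq_ofReal_sqrt {x : ℝ} (hx : 0 ≤ x) : ((√x : ℝ) : ℂ) ^ 2 = x := by
    rw [← Complex.ofReal_pow, Real.sq_sqrt hx]
  have ha := sq_ofReal_sqrt (x := 5 + 5 * lam) (by linarith)
  have hb := sq_ofReal_sqrt (x := 2 + 2 * lam) (by linarith)
  have hc := sq_ofReal_sqrt (x := 1 + lam) (by linarith)
  have hl : (lam : ℂ) = -(s : ℂ) ^ 2 := by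
    rw [← Complex.ofReal_pow, hs]; simp
  have hM : algebraMap ℂ (Matrix (Fin 6) (Fin 6) ℂ) z - (Htoy 0 lam).map ((↑) : ℝ → ℂ) =
      !![z + 5, -(√(5 + 5 * lam) : ℂ), 0, 0, 0, 0;
        (√(5 + 5 * lam) : ℂ), z + 3, -(2 * √(2 + 2 * lam) : ℂ), 0, 0, 0;
        0, (2 * √(2 + 2 * lam) : ℂ), z + 1, -(3 * √(1 + lam) : ℂ), 0, 0;
        0, 0, (3 * √(1 + lam) : ℂ), z - 1, -(2 * √(2 + 2 * lam) : ℂ), 0;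
        0, 0, 0, (2 * √(2 + 2 * lam) : ℂ), z - 3, -(√(5 + 5 * lam) : ℂ);
        0, 0, 0, 0, (√(5 + 5 * lam) : ℂ), z - 5] := by
    ext i j
    fin_cases i <;> fin_cases j <;> simp [Htoy, Matrix.algebraMap_matrix_apply]
  rw [hM, det_tridiagonal_six]
  simp only [mul_pow, ha, hb, hc]
  push_cast
  rw [hl]
  ring

/-- For `−1 < λ < 0` and `s = √(−λ) > 0`, the spectrum of `H_toy(0,λ)` (viewed as a
complex matrix) is exactly the set `{−5s, −3s, −s, s, 3s, 5s}` of six pairwise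
distinct real eigenvalues forming an equidistant sequence with spacing `2s`. -/
theorem stmt15 (lam s : ℝ) (h1 : -1 < lam) (h2 : lam < 0) (hs : s = Real.sqrt (-lam)) :
    0 < s ∧
    ([-5*s, -3*s, -s, s, 3*s, 5*s] : List ℝ).Nodup ∧
    spectrum ℂ ((Htoy 0 lam).map ((↑) : ℝ → ℂ)) =
      ({((-5*s : ℝ) : ℂ), ((-3*s : ℝ) : ℂ), ((-s : ℝ) : ℂ),
        ((s : ℝ) : ℂ), ((3*s : ℝ) : ℂ), ((5*s : ℝ) : ℂ)} : Set ℂ) := by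
  have hpos : 0 < s := hs ▸ Real.sqrt_pos.2 (by linarith)
  have hsq : s ^ 2 = -lam := hs ▸ Real.sq_sqrt (by linarith)
  refine ⟨hpos, ?_, ?_⟩
  · apply List.Pairwise.imp (R := (· < ·)) fun h ↦ h.ne
    simp only [List.pairwise_cons, List.mem_cons, List.not_mem_nil, or_false, forall_eq_or_imp,
      forall_eq, IsEmpty.forall_iff, implies_true, List.Pairwise.nil, and_true]
    refine ⟨⟨?_, ?_, ?_, ?_, ?_⟩, ⟨?_, ?_, ?_, ?_⟩, ⟨?_, ?_, ?_⟩, ⟨?_, ?_⟩, ?_⟩ <;> linarith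
  · ext z
    rw [spectrum.mem_iff, Matrix.isUnit_iff_isUnit_det, isUnit_iff_ne_zero, not_not,
      det_algebraMap_sub_Htoy h1.le hsq]
    simp only [mul_eq_zero, sub_eq_zero, sq_eq_sq_iff_eq_or_eq_neg, Set.mem_insert_iff,
      Set.mem_singleton_iff]
    push_cast
    simp only [neg_mul]
    tauto
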